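/- Let G ∈ R_w and H ∈ R_z be coprime polynomials with z ∈ M. If G is not divisible by any monomial (i.e., by any variable x_j), then for every i ∈ M one has G·R_{z+i} + H·R_{w+i} = R_{w+z+i}. -/

import Mathlib

open Finset

def dotp {n : ℕ} (ξ a : Fin n → ℝ) : ℝ := ∑ i, ξ i * a i

def IsNewtonPolyhedron {n : ℕ} (Δ : Set (Fin n → ℝ)) : Prop :=
  ∃ S : Finset (Fin n → ℝ), S.Nonempty ∧ (∀ a ∈ S, ∀ i, ∃ m : ℕ, a i = (m : ℝ)) ∧
    Δ = {x | ∃ y ∈ convexHull ℝ (S : Set (Fin n → ℝ)),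
          ∃ z : Fin n → ℝ, (∀ i, 0 ≤ z i) ∧ x = y + z}

def NPface {n : ℕ} (Δ : Set (Fin n → ℝ)) (ξ : Fin n → ℝ) : Set (Fin n → ℝ) :=
  {a ∈ Δ | ∀ b ∈ Δ, dotp ξ a ≤ dotp ξ b}

def IsFaceOf {n : ℕ} (Δ A : Set (Fin n → ℝ)) : Prop :=
  ∃ ξ : Fin n → ℝ, (∀ i, 0 ≤ ξ i) ∧ A = NPface Δ ξ

noncomputable def npDim {n : ℕ} (A : Set (Fin n → ℝ)) : ℕ :=
  Module.finrank ℝ (vectorSpan ℝ A)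

def IsLooseEdge {n : ℕ} (Δ E : Set (Fin n → ℝ)) : Prop :=
  IsFaceOf Δ E ∧ IsCompact E ∧ npDim E = 1 ∧
    ∀ F, IsFaceOf Δ F → IsCompact F → 2 ≤ npDim F → ¬ E ⊆ F

/-- Weight of an exponent `α` with respect to the vectors `ξ_j`. -/
def wtF {n m : ℕ} (ξ : Fin m → Fin n → ℕ) (α : Fin n →₀ ℕ) : Fin m → ℕ :=
  fun j => ∑ i, ξ j i * α i

/-- `R_w`: the `K`-span of the monomials of weight `w`. -/
noncomputable def Rw (K : Type*) [Field K] {n m : ℕ} (ξ : Fin m → Fin n → ℕ)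
    (w : Fin m → ℕ) : Submodule K (MvPolynomial (Fin n) K) :=
  Submodule.span K {p | ∃ α : Fin n →₀ ℕ, wtF ξ α = w ∧ p = MvPolynomial.monomial α (1 : K)}

/-- The set `M` of admissible weights: `z ∈ M` iff there is `α ∈ ℤⁿ` of weight `z`
pairing nonnegatively with every `ξ ∈ ℝ_{≥0}ⁿ` orthogonal to the direction `c`. -/
def Mset {n m : ℕ} (ξ : Fin m → Fin n → ℕ) (c : Fin n → ℤ) (z : Fin m → ℕ) : Prop :=
  ∃ α : Fin n → ℤ, (∀ j, ∑ i, (ξ j i : ℤ) * α i = (z j : ℤ)) ∧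
    ∀ η : Fin n → ℝ, (∀ i, 0 ≤ η i) → (∑ i, η i * (c i : ℝ)) = 0 →
      0 ≤ ∑ i, η i * (α i : ℝ)

/-- `c` is a primitive lattice vector. -/
def IsPrimitiveVec {n : ℕ} (c : Fin n → ℤ) : Prop :=
  (Finset.univ.gcd fun i => (c i).natAbs) = 1

/-- The segment `E` is parallel to the vector `c`. -/
def ParallelTo {n : ℕ} (E : Set (Fin n → ℝ)) (c : Fin n → ℤ) : Prop :=
  ∃ a b : Fin n → ℝ, a ≠ b ∧ E = segment ℝ a b ∧
    ∃ t : ℝ, (b - a) = t • (fun i => (c i : ℝ))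

/-- `ξ_1, …, ξ_{n-1}` are linearly independent and orthogonal to `c`. -/
def OrthSetup {n m : ℕ} (ξ : Fin m → Fin n → ℕ) (c : Fin n → ℤ) : Prop :=
  LinearIndependent ℝ (fun j => fun i => ((ξ j i : ℝ))) ∧
  ∀ j, ∑ i, (ξ j i : ℤ) * c i = 0

/-- Relatively prime polynomials: no nonconstant (non-unit) common factor. -/
def RelPrime {R : Type*} [CommRing R] (G H : R) : Prop :=
  ∀ d : R, d ∣ G → d ∣ H → IsUnit d

lemma aux_pos_neg {n : ℕ} (Δ E : Set (Fin n → ℝ)) (hΔ : IsNewtonPolyhedron Δ)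
    (hE : IsLooseEdge Δ E) (c : Fin n → ℤ) (hprim : IsPrimitiveVec c) (hpar : ParallelTo E c) :
    (∃ p, 0 < c p) ∧ ∃ q, c q < 0 := by
  obtain ⟨⟨ν, hν0, hEν⟩, hcomp, -, -⟩ := hE
  obtain ⟨a, b, hab, hseg, t, ht⟩ := hpar
  have ha : a ∈ NPface Δ ν := by rw [← hEν, hseg]; exact left_mem_segment ℝ a b
  have hb : b ∈ NPface Δ ν := by rw [← hEν, hseg]; exact right_mem_segment ℝ a b
  have hνpos : ∀ i, 0 < ν i := by
    intro i
    by_contra hcon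
    have h0 : ν i = 0 := le_antisymm (not_lt.mp hcon) (hν0 i)
    have hmem : ∀ s : ℝ, 0 ≤ s → a + Pi.single i s ∈ E := by
      intro s hs
      rw [hEν]
      refine ⟨?_, ?_⟩
      · obtain ⟨S, -, -, hS⟩ := hΔ
        have haΔ := ha.1
        rw [hS] at haΔ ⊢
        obtain ⟨y, hy, z, hz, hyz⟩ := haΔ
        refine ⟨y, hy, z + Pi.single i s, ?_, ?_⟩
        · intro j
          have := hz j
          by_cases hj : j = i
          · subst hj; simp; linarith
          · simp [hj, this]
        · rw [hyz, add_assoc]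
      · intro b' hb'
        have := ha.2 b' hb'
        have e : dotp ν (a + Pi.single i s) = dotp ν a := by
          simp [dotp, mul_add, Finset.sum_add_distrib, Pi.single_apply, h0]
        rw [e]; exact this
    have hbd := (hcomp.image (continuous_apply i)).isBounded.bddAbove
    obtain ⟨B, hB⟩ := hbd
    have h1 := hB ⟨_, hmem (|B| + |a i| + 1) (by positivity), rfl⟩
    simp at h1
    have := le_abs_self B
    have := neg_abs_le (a i)
    linarith
  have hdot : dotp ν a = dotp ν b := le_antisymm (ha.2 b hb.1) (hb.2 a ha.1)
  have ht0 : t ≠ 0 := by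
    rintro rfl
    apply hab
    have : b - a = 0 := by rw [ht]; simp
    exact (sub_eq_zero.mp this).symm
  have hsum : ∑ i, ν i * (c i : ℝ) = 0 := by
    have h1 : ∑ i, ν i * (b - a) i = 0 := by
      simp only [Pi.sub_apply, mul_sub, Finset.sum_sub_distrib]
      unfold dotp at hdot
      linarith
    rw [ht] at h1
    have h2 : t * ∑ i, ν i * (c i : ℝ) = 0 := by
      rw [Finset.mul_sum, ← h1]
      refine Finset.sum_congr rfl fun i _ => ?_
      simp; ring
    exact (mul_eq_zero.mp h2).resolve_left ht0
  have hc0 : ∃ i, c i ≠ 0 := by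
    by_contra hcon
    push Not at hcon
    unfold IsPrimitiveVec at hprim
    have : (Finset.univ.gcd fun i => (c i).natAbs) = 0 := by
      rw [Finset.gcd_eq_zero_iff]; simp [hcon]
    omega
  obtain ⟨i0, hi0⟩ := hc0
  constructor
  · by_contra hcon
    push Not at hcon
    have h1 := (Finset.sum_eq_zero_iff_of_nonpos (s := Finset.univ)
      (f := fun i => ν i * (c i : ℝ)) (fun i _ =>
        mul_nonpos_of_nonneg_of_nonpos (hν0 i) (by exact_mod_cast hcon i))).mp hsum i0 (by simp)
    rcases mul_eq_zero.mp h1 with h | h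
    · exact (hνpos i0).ne' h
    · exact hi0 (by exact_mod_cast h)
  · by_contra hcon
    push Not at hcon
    have h1 := (Finset.sum_eq_zero_iff_of_nonneg (s := Finset.univ)
      (f := fun i => ν i * (c i : ℝ)) (fun i _ =>
        mul_nonneg (hν0 i) (by exact_mod_cast hcon i))).mp hsum i0 (by simp)
    rcases mul_eq_zero.mp h1 with h | h
    · exact (hνpos i0).ne' h
    · exact hi0 (by exact_mod_cast h)

lemma aux_count {n : ℕ} (c α : Fin n → ℤ) (hp : ∃ p, 0 < c p) (hq : ∃ q, c q < 0)
    (hM : ∀ η : Fin n → ℝ, (∀ i, 0 ≤ η i) → (∑ i, η i * (c i : ℝ)) = 0 →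
      0 ≤ ∑ i, η i * (α i : ℝ)) :
    ∃ L U : ℤ, L ≤ U + 1 ∧ ∀ (d : ℕ) (k : ℤ),
      (∀ i, 0 ≤ α i + d * max (-c i) 0 + k * c i) ↔ L ≤ k ∧ k ≤ U + d := by
  obtain ⟨p, hpm, hpmax⟩ := Finset.exists_max_image (Finset.univ.filter fun i => 0 < c i)
    (fun i => -(α i / c i)) (by obtain ⟨p, hp⟩ := hp; exact ⟨p, by simp [hp]⟩)
  obtain ⟨q, hqm, hqmin⟩ := Finset.exists_min_image (Finset.univ.filter fun i => c i < 0)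
    (fun i => (α i / (-c i))) (by obtain ⟨p, hp⟩ := hq; exact ⟨p, by simp [hp]⟩)
  simp only [Finset.mem_filter, Finset.mem_univ, true_and] at hpm hpmax hqm hqmin
  refine ⟨-(α p / c p), α q / (-c q), ?_, ?_⟩
  · have hpq : p ≠ q := by rintro rfl; omega
    have h := hM (Pi.single p (-(c q : ℝ)) + Pi.single q (c p : ℝ)) ?_ ?_
    · simp [add_mul, Finset.sum_add_distrib, Pi.single_apply] at h
      have h' : 0 ≤ (-c q) * α p + c p * α q := by
        have : (0 : ℝ) ≤ (((-c q) * α p + c p * α q : ℤ) : ℝ) := by push_cast; linarith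
        exact_mod_cast this
      have h1 : α p < c p * (α p / c p + 1) := by
        have := Int.mul_ediv_add_emod (α p) (c p)
        have := Int.emod_lt_of_pos (α p) hpm
        linarith
      have h2 : α q < (-c q) * (α q / (-c q) + 1) := by
        have := Int.mul_ediv_add_emod (α q) (-c q)
        have := Int.emod_lt_of_pos (α q) (b := -c q) (by omega)
        linarith
      by_contra hcon
      push Not at hcon
      generalize α p / c p = x at *
      generalize α q / (-c q) = y at *
      generalize hC : -c q = C at *
      have hC0 : 0 < C := by omega
      have h3 := mul_lt_mul_of_pos_left h1 hC0
      have h4 := mul_lt_mul_of_pos_left h2 hpm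
      have h5 : 0 < c p * C * (x + y + 2) := by nlinarith
      have h6 : 0 < c p * C := mul_pos hpm hC0
      have h7 : 0 < x + y + 2 := pos_of_mul_pos_right h5 h6.le
      omega
    · intro i
      have e1 : (0 : ℝ) ≤ -(c q : ℝ) := by
        have : (c q : ℝ) < 0 := by exact_mod_cast hqm
        linarith
      have e2 : (0 : ℝ) ≤ (c p : ℝ) := by exact_mod_cast hpm.le
      simp only [Pi.add_apply, Pi.single_apply]
      split_ifs <;> linarith
    · simp [add_mul, Finset.sum_add_distrib, Pi.single_apply]
      ring
  · intro d k
    have key1 : ∀ i, 0 < c i → (0 ≤ α i + d * max (-c i) 0 + k * c i ↔ -(α i / c i) ≤ k) := by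
      intro i hi
      rw [max_eq_right (by omega)]
      have := Int.le_ediv_iff_mul_le (a := -k) (b := α i) hi
      constructor
      · intro h
        have := this.mpr (by linarith)
        omega
      · intro h
        have := this.mp (by omega)
        linarith
    have key2 : ∀ i, c i < 0 → (0 ≤ α i + d * max (-c i) 0 + k * c i ↔ k ≤ α i / (-c i) + d) := by
      intro i hi
      rw [max_eq_left (by omega)]
      have := Int.le_ediv_iff_mul_le (a := k - d) (b := α i) (c := -c i) (by omega)
      constructor
      · intro h
        have := this.mpr (by linarith)
        omega
      · intro h
        have := this.mp (by omega)
        linarith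
    constructor
    · intro h
      exact ⟨(key1 p hpm).mp (h p), (key2 q hqm).mp (h q)⟩
    · rintro ⟨h1, h2⟩ i
      rcases lt_trichotomy (c i) 0 with hi | hi | hi
      · rw [key2 i hi]
        have := hqmin i hi
        omega
      · have h := hM (Pi.single i 1) ?_ ?_
        · simp [Pi.single_apply] at h
          simp [hi, h]
        · intro j
          simp only [Pi.single_apply]
          split_ifs <;> norm_num
        · simp [Pi.single_apply, hi]
      · rw [key1 i hi]
        have := hpmax i hi
        omega

lemma aux_kernel {n : ℕ} (c : Fin n → ℤ) (hprim : IsPrimitiveVec c)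
    (ξ : Fin (n-1) → Fin n → ℕ) (horth : OrthSetup ξ c) (β : Fin n → ℤ)
    (hβ : ∀ j, ∑ i, (ξ j i : ℤ) * β i = 0) : ∃ k : ℤ, ∀ i, β i = k * c i := by
  have hc0 : ∃ i, c i ≠ 0 := by
    by_contra hcon
    push Not at hcon
    unfold IsPrimitiveVec at hprim
    have : (Finset.univ.gcd fun i => (c i).natAbs) = 0 := by
      rw [Finset.gcd_eq_zero_iff]; simp [hcon]
    omega
  obtain ⟨p, hp⟩ := hc0
  have hn : 0 < n := p.pos
  obtain ⟨hli, hoc⟩ := horth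
  let A : Matrix (Fin (n-1)) (Fin n) ℝ := fun j i => (ξ j i : ℝ)
  have hmem : ∀ γ : Fin n → ℤ, (∀ j, ∑ i, (ξ j i : ℤ) * γ i = 0) →
      (fun i => (γ i : ℝ)) ∈ LinearMap.ker A.mulVecLin := by
    intro γ hγ
    rw [LinearMap.mem_ker]
    ext j
    change ∑ i, (ξ j i : ℝ) * (γ i : ℝ) = 0
    exact_mod_cast hγ j
  have hrank : A.rank = n - 1 := by
    have := LinearIndependent.rank_matrix (M := A) hli
    simpa using this
  have hker : Module.finrank ℝ (LinearMap.ker A.mulVecLin) = 1 := by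
    have := LinearMap.finrank_range_add_finrank_ker A.mulVecLin
    rw [Matrix.rank] at hrank
    simp at this
    omega
  have hcne : (⟨_, hmem c hoc⟩ : LinearMap.ker A.mulVecLin) ≠ 0 := by
    intro h
    have := congrFun (congrArg Subtype.val h) p
    simp at this
    exact hp this
  obtain ⟨t, ht⟩ := (finrank_eq_one_iff_of_nonzero' _ hcne).mp hker ⟨_, hmem β hβ⟩
  have ht' : ∀ i, t * (c i : ℝ) = β i := fun i => by
    simpa using congrFun (congrArg Subtype.val ht) i
  have hcross : ∀ i, c p * β i = β p * c i := by
    intro i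
    have : (c p : ℝ) * β i = β p * c i := by rw [← ht' i, ← ht' p]; ring
    exact_mod_cast this
  have hdvd : c p ∣ β p := by
    rw [← Int.natAbs_dvd_natAbs]
    have h1 : (c p).natAbs ∣ Finset.univ.gcd fun i => (β p).natAbs * (c i).natAbs := by
      apply Finset.dvd_gcd
      intro i _
      rw [← Int.natAbs_mul, ← hcross, Int.natAbs_mul]
      exact Dvd.intro _ rfl
    rw [Finset.gcd_mul_left, hprim] at h1
    simpa using h1
  obtain ⟨k, hk⟩ := hdvd
  refine ⟨k, fun i => ?_⟩
  have := hcross i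
  rw [hk, mul_assoc] at this
  exact mul_left_cancel₀ hp this

lemma aux_card {n : ℕ} (c : Fin n → ℤ) (hprim : IsPrimitiveVec c) (hp : ∃ p, 0 < c p)
    (ξ : Fin (n-1) → Fin n → ℕ) (horth : OrthSetup ξ c) (v : Fin (n-1) → ℕ)
    (β : Fin n → ℤ) (hβ : ∀ j, ∑ i, (ξ j i : ℤ) * β i = v j) (L U : ℤ)
    (hLU : ∀ k : ℤ, (∀ i, 0 ≤ β i + k * c i) ↔ L ≤ k ∧ k ≤ U) :
    {α : Fin n →₀ ℕ | wtF ξ α = v}.Finite ∧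
      {α : Fin n →₀ ℕ | wtF ξ α = v}.ncard = (U + 1 - L).toNat := by
  obtain ⟨p, hp⟩ := hp
  let f : ℤ → (Fin n →₀ ℕ) := fun k => Finsupp.equivFunOnFinite.symm fun i => (β i + k * c i).toNat
  have himg : {α : Fin n →₀ ℕ | wtF ξ α = v} = f '' (Set.Icc L U) := by
    ext α
    simp only [Set.mem_ofPred_eq, Set.mem_image, Set.mem_Icc]
    constructor
    · intro h
      obtain ⟨k, hk⟩ := aux_kernel c hprim ξ horth (fun i => (α i : ℤ) - β i) (by
        intro j
        simp only [mul_sub, Finset.sum_sub_distrib, hβ]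
        rw [← h]
        simp [wtF])
      refine ⟨k, (hLU k).mp fun i => ?_, ?_⟩
      · have := hk i
        omega
      · ext i
        have := hk i
        simp only [f, Finsupp.coe_equivFunOnFinite_symm]
        omega
    · rintro ⟨k, hk, rfl⟩
      have hk' := (hLU k).mpr hk
      ext j
      have : ((wtF ξ (f k) j : ℕ) : ℤ) = v j := by
        simp only [wtF, f, Finsupp.coe_equivFunOnFinite_symm]
        push_cast
        rw [← hβ j]
        have h2 := horth.2 j
        calc _ = ∑ i, ((ξ j i : ℤ) * β i + k * ((ξ j i : ℤ) * c i)) := by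
              refine Finset.sum_congr rfl fun i _ => ?_
              rw [Int.toNat_of_nonneg (hk' i)]; ring
          _ = _ := by rw [Finset.sum_add_distrib, ← Finset.mul_sum, h2]; simp
      exact_mod_cast this
  have hinj : Set.InjOn f (Set.Icc L U) := by
    intro k hk k' hk' h
    have h1 := (hLU k).mpr hk p
    have h2 := (hLU k').mpr hk' p
    have h3 := DFunLike.congr_fun h p
    simp only [f, Finsupp.coe_equivFunOnFinite_symm] at h3
    have h4 : k * c p = k' * c p := by omega
    exact mul_right_cancel₀ hp.ne' h4
  rw [himg]
  refine ⟨(Set.finite_Icc L U).image f, ?_⟩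
  rw [Set.ncard_image_of_injOn hinj, ← Finset.coe_Icc, Set.ncard_coe_finset, Int.card_Icc]

lemma Rw_eq_restrict (K : Type*) [Field K] {n m : ℕ} (ξ : Fin m → Fin n → ℕ) (v : Fin m → ℕ) :
    Rw K ξ v = MvPolynomial.restrictSupport K {α : Fin n →₀ ℕ | wtF ξ α = v} := by
  rw [MvPolynomial.restrictSupport_eq_span, Rw]
  congr 1
  ext p
  simp only [Set.mem_ofPred_eq, Set.mem_image]
  constructor
  · rintro ⟨a, h, rfl⟩; exact ⟨a, h, rfl⟩
  · rintro ⟨a, h, rfl⟩; exact ⟨a, h, rfl⟩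

lemma mem_Rw (K : Type*) [Field K] {n m : ℕ} (ξ : Fin m → Fin n → ℕ) (v : Fin m → ℕ)
    (p : MvPolynomial (Fin n) K) : p ∈ Rw K ξ v ↔ ∀ α ∈ p.support, wtF ξ α = v := by
  rw [Rw_eq_restrict, MvPolynomial.mem_restrictSupport_iff]
  rfl

lemma Rw_eq_weighted (K : Type*) [Field K] {n m : ℕ} (ξ : Fin m → Fin n → ℕ) (v : Fin m → ℕ) :
    Rw K ξ v = MvPolynomial.weightedHomogeneousSubmodule K (fun i j => ξ j i) v := by
  ext p
  rw [mem_Rw, MvPolynomial.mem_weightedHomogeneousSubmodule]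
  have : ∀ α : Fin n →₀ ℕ, wtF ξ α = Finsupp.weight (fun i j => ξ j i) α := by
    intro α
    ext j
    rw [Finsupp.weight_apply, Finsupp.sum_fintype _ _ (by simp)]
    simp [wtF, mul_comm]
  simp only [MvPolynomial.mem_support_iff, this]
  rfl

lemma Rw_mul_mem (K : Type*) [Field K] {n m : ℕ} (ξ : Fin m → Fin n → ℕ) (v u : Fin m → ℕ)
    (p q : MvPolynomial (Fin n) K) (hp : p ∈ Rw K ξ v) (hq : q ∈ Rw K ξ u) :
    p * q ∈ Rw K ξ (v + u) := by
  rw [Rw_eq_weighted] at *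
  exact MvPolynomial.IsWeightedHomogeneous.mul hp hq

lemma Rw_cancel (K : Type*) [Field K] {n m : ℕ} (ξ : Fin m → Fin n → ℕ) (v u : Fin m → ℕ)
    (p q : MvPolynomial (Fin n) K) (hp : p ∈ Rw K ξ v) (hp0 : p ≠ 0)
    (hpq : p * q ∈ Rw K ξ (v + u)) : q ∈ Rw K ξ u := by
  classical
  rw [Rw_eq_weighted] at *
  let 𝒜 := MvPolynomial.weightedHomogeneousSubmodule K (fun (i : Fin n) (j : Fin m) => ξ j i)
  letI : GradedAlgebra 𝒜 := MvPolynomial.weightedGradedAlgebra K _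
  have h1 := DirectSum.coe_decompose_mul_add_of_left_mem 𝒜 (a := p) (b := q) (i := v) (j := u) hp
  rw [DirectSum.decompose_of_mem_same 𝒜 hpq] at h1
  have h2 := mul_left_cancel₀ hp0 h1
  rw [h2]
  exact SetLike.coe_mem _

lemma Rw_finrank (K : Type*) [Field K] {n m : ℕ} (ξ : Fin m → Fin n → ℕ) (v : Fin m → ℕ)
    (hfin : {α : Fin n →₀ ℕ | wtF ξ α = v}.Finite) :
    FiniteDimensional K (Rw K ξ v) ∧
      Module.finrank K (Rw K ξ v) = {α : Fin n →₀ ℕ | wtF ξ α = v}.ncard := by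
  rw [Rw_eq_restrict]
  have := hfin.to_subtype
  refine ⟨Module.Basis.finiteDimensional_of_finite (MvPolynomial.basisRestrictSupport K _), ?_⟩
  rw [Module.finrank_eq_nat_card_basis (MvPolynomial.basisRestrictSupport K _)]
  rfl

lemma aux_G (K : Type*) [Field K] {n : ℕ} (c : Fin n → ℤ) (hprim : IsPrimitiveVec c)
    (hp : ∃ p, 0 < c p)
    (ξ : Fin (n-1) → Fin n → ℕ) (horth : OrthSetup ξ c) (w : Fin (n-1) → ℕ)
    (G : MvPolynomial (Fin n) K) (hG : G ∈ Rw K ξ w)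
    (hdiv : ∀ j : Fin n, ¬ (MvPolynomial.X j ∣ G)) :
    ∃ d : ℕ, ∀ j, ∑ i, (ξ j i : ℤ) * (d * max (-c i) 0) = w j := by
  obtain ⟨p, hp⟩ := hp
  rw [mem_Rw] at hG
  have hz : ∀ q, ∃ m ∈ G.support, m q = 0 := by
    intro q
    by_contra hcon
    push Not at hcon
    apply hdiv q
    rw [G.as_sum]
    apply Finset.dvd_sum
    intro m hm
    rw [MvPolynomial.X_dvd_monomial]
    exact Or.inr (hcon m hm)
  have hne : G.support.Nonempty := by
    obtain ⟨m, hm, -⟩ := hz p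
    exact ⟨m, hm⟩
  have hdiff : ∀ a ∈ G.support, ∀ b ∈ G.support, ∃ k : ℤ, ∀ i, (b i : ℤ) - a i = k * c i := by
    intro a ha b hb
    refine aux_kernel c hprim ξ horth (fun i => (b i : ℤ) - a i) fun j => ?_
    have h1 := congrFun (hG a ha) j
    have h2 := congrFun (hG b hb) j
    simp only [wtF] at h1 h2
    simp only [mul_sub, Finset.sum_sub_distrib]
    rw [sub_eq_zero]
    exact_mod_cast h2.trans h1.symm
  obtain ⟨e0, he0, hmin⟩ := Finset.exists_min_image G.support (fun m => m p) hne
  obtain ⟨e1, he1, hmax⟩ := Finset.exists_max_image G.support (fun m => m p) hne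
  obtain ⟨d, hd⟩ := hdiff e0 he0 e1 he1
  have hd0 : 0 ≤ d := by
    have h1 := hd p
    have h2 := hmin e1 he1
    have h3 : 0 ≤ d * c p := by omega
    exact nonneg_of_mul_nonneg_left h3 hp
  have hval : ∀ i, (e0 i : ℤ) = d * max (-c i) 0 := by
    intro i
    obtain ⟨m, hm, hmi⟩ := hz i
    rcases le_or_gt 0 (c i) with hi | hi
    · rw [max_eq_right (by omega), mul_zero]
      obtain ⟨k, hk⟩ := hdiff e0 he0 m hm
      have hk0 : 0 ≤ k := by
        have h1 := hk p
        have h2 := hmin m hm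
        have h3 : 0 ≤ k * c p := by omega
        exact nonneg_of_mul_nonneg_left h3 hp
      have h1 := hk i
      have h2 := mul_nonneg hk0 hi
      omega
    · rw [max_eq_left (by omega)]
      obtain ⟨k, hk⟩ := hdiff m hm e1 he1
      have hk0 : 0 ≤ k := by
        have h1 := hk p
        have h2 := hmax m hm
        have h3 : 0 ≤ k * c p := by omega
        exact nonneg_of_mul_nonneg_left h3 hp
      have h1 := hk i
      have h2 := mul_nonpos_of_nonneg_of_nonpos hk0 hi.le
      have h3 := hd i
      rw [mul_neg]
      omega
  refine ⟨d.toNat, fun j => ?_⟩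
  rw [Int.toNat_of_nonneg hd0]
  simp only [← hval]
  rw [← hG e0 he0]
  simp [wtF]

lemma aux_dim (K : Type*) [Field K] {n : ℕ} (c : Fin n → ℤ) (hprim : IsPrimitiveVec c)
    (hp : ∃ p, 0 < c p) (hq : ∃ q, c q < 0)
    (ξ : Fin (n-1) → Fin n → ℕ) (horth : OrthSetup ξ c) (w v : Fin (n-1) → ℕ)
    (d : ℕ) (hd : ∀ j, ∑ i, (ξ j i : ℤ) * (d * max (-c i) 0) = w j)
    (hv : Mset ξ c v) :
    FiniteDimensional K (Rw K ξ v) ∧ FiniteDimensional K (Rw K ξ (w + v)) ∧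
      Module.finrank K (Rw K ξ (w + v)) = Module.finrank K (Rw K ξ v) + d := by
  obtain ⟨α, hα, hM⟩ := hv
  obtain ⟨L, U, hLU, hcount⟩ := aux_count c α hp hq hM
  obtain ⟨f1, c1⟩ := aux_card c hprim hp ξ horth v α hα L U (fun k => by
    have := hcount 0 k
    simpa using this)
  obtain ⟨f2, c2⟩ := aux_card c hprim hp ξ horth (w + v) (fun i => α i + d * max (-c i) 0)
    (fun j => by
      simp only [mul_add, Finset.sum_add_distrib, hα, hd, Pi.add_apply]
      push_cast; ring) L (U + d) (hcount d)
  obtain ⟨g1, r1⟩ := Rw_finrank K ξ v f1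
  obtain ⟨g2, r2⟩ := Rw_finrank K ξ (w + v) f2
  refine ⟨g1, g2, ?_⟩
  rw [r1, r2, c1, c2]
  omega

/-- if `G ∈ R_w`, `H ∈ R_z` are coprime, `z ∈ M`, and `G` is not
divisible by any variable, then `G·R_{z+i} + H·R_{w+i} = R_{w+z+i}` for all `i ∈ M`. -/
theorem surjectivity_lemma (K : Type*) [Field K] {n : ℕ} (Δ E : Set (Fin n → ℝ))
    (hΔ : IsNewtonPolyhedron Δ) (hE : IsLooseEdge Δ E)
    (c : Fin n → ℤ) (hprim : IsPrimitiveVec c) (hpar : ParallelTo E c)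
    (ξ : Fin (n-1) → Fin n → ℕ) (horth : OrthSetup ξ c)
    (w z : Fin (n-1) → ℕ) (hz : Mset ξ c z)
    (G H : MvPolynomial (Fin n) K) (hG : G ∈ Rw K ξ w) (hH : H ∈ Rw K ξ z)
    (hcop : RelPrime G H) (hdiv : ∀ j : Fin n, ¬ (MvPolynomial.X j ∣ G)) :
    ∀ i : Fin (n-1) → ℕ, Mset ξ c i →
      (Rw K ξ (z + i)).map (LinearMap.mulLeft K G) ⊔
        (Rw K ξ (w + i)).map (LinearMap.mulLeft K H) = Rw K ξ (w + z + i) := by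
  intro i hi
  obtain ⟨hp, hq⟩ := aux_pos_neg Δ E hΔ hE c hprim hpar
  obtain ⟨d, hd⟩ := aux_G K c hprim hp ξ horth w G hG hdiv
  have hzi : Mset ξ c (z + i) := by
    obtain ⟨α, h1, h2⟩ := hz
    obtain ⟨β, h3, h4⟩ := hi
    refine ⟨α + β, fun j => ?_, fun η h5 h6 => ?_⟩
    · simp [mul_add, Finset.sum_add_distrib, h1, h3]
    · have := h2 η h5 h6
      have := h4 η h5 h6
      simp only [Pi.add_apply, Int.cast_add, mul_add, Finset.sum_add_distrib]
      linarith
  obtain ⟨fi, fwi, di⟩ := aux_dim K c hprim hp hq ξ horth w i d hd hi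
  obtain ⟨fzi, fwzi, dzi⟩ := aux_dim K c hprim hp hq ξ horth w (z + i) d hd hzi
  have hG0 : G ≠ 0 := by
    rintro rfl
    exact hdiv hp.choose (dvd_zero _)
  rw [add_assoc]
  apply Submodule.eq_of_le_of_finrank_le
  · apply sup_le
    · rintro _ ⟨ψ, hψ, rfl⟩
      exact Rw_mul_mem K ξ _ _ _ _ hG hψ
    · rintro _ ⟨φ, hφ, rfl⟩
      have := Rw_mul_mem K ξ _ _ _ _ hH hφ
      rwa [add_left_comm] at this
  · let f : (Rw K ξ (z + i) × Rw K ξ (w + i)) →ₗ[K] MvPolynomial (Fin n) K :=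
      LinearMap.coprod ((LinearMap.mulLeft K G).comp (Rw K ξ (z + i)).subtype)
        ((LinearMap.mulLeft K H).comp (Rw K ξ (w + i)).subtype)
    have hrange : LinearMap.range f = (Rw K ξ (z + i)).map (LinearMap.mulLeft K G) ⊔
        (Rw K ξ (w + i)).map (LinearMap.mulLeft K H) := by
      simp only [f, LinearMap.range_coprod, LinearMap.range_comp, Submodule.range_subtype]
    have hf : ∀ x, f x = G * (x.1 : MvPolynomial (Fin n) K) + H * (x.2 : MvPolynomial (Fin n) K) :=
      fun x => by simp [f]
    let g : LinearMap.ker f →ₗ[K] MvPolynomial (Fin n) K :=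
      ((Rw K ξ (w + i)).subtype.comp (LinearMap.snd K _ _)).comp (LinearMap.ker f).subtype
    have hginj : Function.Injective g := by
      rintro ⟨⟨ψ, φ⟩, hx⟩ ⟨⟨ψ₂, φ₂⟩, hy⟩ h
      have hφ : (φ : MvPolynomial (Fin n) K) = φ₂ := h
      rw [LinearMap.mem_ker, hf] at hx hy
      simp only [hφ] at hx hy
      have hψ : (ψ : MvPolynomial (Fin n) K) = ψ₂ :=
        mul_left_cancel₀ hG0 (by linear_combination hx - hy)
      exact Subtype.ext (Prod.ext (Subtype.ext hψ) (Subtype.ext hφ))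
    have hgr : LinearMap.range g ≤ (Rw K ξ i).map (LinearMap.mulLeft K G) := by
      rintro _ ⟨⟨⟨ψ, φ⟩, hx⟩, rfl⟩
      rw [LinearMap.mem_ker, hf] at hx
      have hrel : IsRelPrime G H := fun a h1 h2 => hcop a h1 h2
      have hdvd : G ∣ H * (φ : MvPolynomial (Fin n) K) :=
        ⟨-ψ, by linear_combination hx⟩
      obtain ⟨η, hη⟩ := hrel.dvd_of_dvd_mul_left hdvd
      refine ⟨η, ?_, hη.symm⟩
      apply Rw_cancel K ξ w i G η hG hG0
      rw [← hη]
      exact φ.2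
    have h1 := LinearMap.finrank_range_add_finrank_ker f
    have h2 : Module.finrank K (LinearMap.ker f) ≤ Module.finrank K (Rw K ξ i) := by
      rw [← LinearMap.finrank_range_of_inj hginj]
      exact (Submodule.finrank_mono hgr).trans (Submodule.finrank_map_le _ _)
    rw [Module.finrank_prod] at h1
    rw [← hrange]
    omega
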